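/- The quantum Pauli matrices satisfy the completeness relations: for each sign choice and all α,β,ρ,σ ∈ {1,2}, Σ_I σ^{I β̇}_{α} σ̄_{±Iρ̇}^{σ} = Q δ^σ_α δ^{β̇}_{ρ̇} and Σ_I σ_{±I β̇}^{α} σ̄^{I ρ̇}_{±σ} = Q δ^α_σ δ^{ρ̇}_{β̇}, where σ^{I β̇}_{α} := Σ_ρ ε^{β̇ρ̇} σ^I_{αρ̇}, σ̄_{±Iρ̇}^{σ} := Σ_{γ,N} ε_{ρ̇γ̇} G_{±IN} σ̄_±^{Nγ̇σ}, σ_{±I β̇}^{α} := Σ_{ρ,J} G_{±IJ} σ^J_{ρβ̇} ε^{ρα}, and σ̄^{I ρ̇}_{±σ} := Σ_β σ̄_±^{Iρ̇β} ε_{βσ}. -/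

import Mathlib

noncomputable section

open scoped Matrix

/-- Lower undotted spinor metric `ε_{αβ}` of the two-parameter deformation. -/
def epsLo (q r : ℝ) : Matrix (Fin 2) (Fin 2) ℂ :=
  ((Real.sqrt (1 - r ^ 2) : ℂ))⁻¹ •
    !![Complex.I * (r : ℂ), -((Real.sqrt q : ℂ))⁻¹; (Real.sqrt q : ℂ), Complex.I * (r : ℂ)]

/-- Upper undotted spinor metric `ε^{αβ}`. -/
def epsUp (q r : ℝ) : Matrix (Fin 2) (Fin 2) ℂ :=
  ((Real.sqrt (1 - r ^ 2) : ℂ))⁻¹ •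
    !![Complex.I * (r : ℂ), ((Real.sqrt q : ℂ))⁻¹; -(Real.sqrt q : ℂ), Complex.I * (r : ℂ)]

/-- Lower dotted spinor metric `ε_{α̇β̇}`. -/
def epsLoD (q r : ℝ) : Matrix (Fin 2) (Fin 2) ℂ :=
  ((Real.sqrt (1 - r ^ 2) : ℂ))⁻¹ •
    !![-(Complex.I * (r : ℂ)), (Real.sqrt q : ℂ); -((Real.sqrt q : ℂ))⁻¹, -(Complex.I * (r : ℂ))]

/-- Upper dotted spinor metric `ε^{α̇β̇}`. -/
def epsUpD (q r : ℝ) : Matrix (Fin 2) (Fin 2) ℂ :=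
  ((Real.sqrt (1 - r ^ 2) : ℂ))⁻¹ •
    !![-(Complex.I * (r : ℂ)), -(Real.sqrt q : ℂ); ((Real.sqrt q : ℂ))⁻¹, -(Complex.I * (r : ℂ))]

/-- `Q = (2r + q + q⁻¹)/(1 − r²)`. -/
def Qval (q r : ℝ) : ℝ := (2 * r + q + q⁻¹) / (1 - r ^ 2)

/-- The R-matrix `R^{αβ}_{γδ} = δ^α_γ δ^β_δ + c · ε^{αβ} ε_{γδ}` (with `c = a^{±1}`). -/
def Rm (q r : ℝ) (c : ℂ) (α β γ δ : Fin 2) : ℂ :=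
  (if α = γ then 1 else 0) * (if β = δ then 1 else 0) + c * epsUp q r α β * epsLo q r γ δ

/-- The conjugate `σ̄_±^{α̇β} = a^{±1/2} Σ ε^{α̇λ̇} ε_{ρκ} R^{∓σκ}_{μν} ε^{μλ} ε^{νβ} σ_{σρ̇}`
of a 2×2 matrix `σ`; `s = true` is the `+` sign, `s = false` the `−` sign. -/
def sbar (q r a : ℝ) (s : Bool) (σ : Matrix (Fin 2) (Fin 2) ℂ) (ad b : Fin 2) : ℂ :=
  (if s then (Real.sqrt a : ℂ) else ((Real.sqrt a : ℂ))⁻¹) *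
    ∑ l, ∑ sg, ∑ rh, ∑ ka, ∑ mu, ∑ nu,
      epsUpD q r ad l * epsLo q r rh ka * Rm q r (if s then ((a : ℂ))⁻¹ else (a : ℂ)) sg ka mu nu *
        epsUp q r mu l * epsUp q r nu b * σ sg rh

/-- The quantum Pauli matrices `σ^0, σ^1, σ^2, σ^3`. -/
def pauli : Fin 4 → Matrix (Fin 2) (Fin 2) ℂ :=
  ![!![1, 0; 0, 1], !![0, 1; 1, 0], !![0, -Complex.I; Complex.I, 0], !![1, 0; 0, -1]]

/-- The metric pairing `G_±^{IJ} = (1/Q) Σ ε^{αν} σ^I_{αβ̇} σ̄_±^{Jβ̇γ} ε_{γν}`. -/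
def Gpair (q r a : ℝ) (s : Bool) (σI σJ : Matrix (Fin 2) (Fin 2) ℂ) : ℂ :=
  (1 / (Qval q r : ℂ)) * ∑ al, ∑ nu, ∑ be, ∑ ga,
    epsUp q r al nu * σI al be * sbar q r a s σJ be ga * epsLo q r ga nu

/-- The quantum Minkowski metric `G_±^{IJ}` as a 4×4 matrix. -/
def GupM (q r a : ℝ) (s : Bool) : Matrix (Fin 4) (Fin 4) ℂ :=
  fun I J => Gpair q r a s (pauli I) (pauli J)

/-- The inverse metric `G_{±IJ}`. -/
def GloM (q r a : ℝ) (s : Bool) : Matrix (Fin 4) (Fin 4) ℂ := (GupM q r a s)⁻¹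

/-- The lowered conjugate Pauli matrices `σ̄_L^{α̇β} = Σ_N G_{+LN} σ̄_+^{Nα̇β}`. -/
def sbarL (q r a : ℝ) (L : Fin 4) (ad b : Fin 2) : ℂ :=
  ∑ N, GloM q r a true L N * sbar q r a true (pauli N) ad b

/-- The quantum Lorentz group generators
`Λ_L^K = (1/Q) Σ ε_{γ̇δ̇} σ̄_L^{δ̇α} M_α^σ σ^K_{σρ̇} M̄_β̇^{ρ̇} ε^{γ̇β̇}`. -/
def Lor {A : Type*} [Ring A] [Algebra ℂ A] (q r a : ℝ)
    (M Mb : Fin 2 → Fin 2 → A) (L K : Fin 4) : A :=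
  ∑ ga, ∑ de, ∑ al, ∑ sg, ∑ rh, ∑ be,
    ((1 / (Qval q r : ℂ)) * epsLoD q r ga de * sbarL q r a L de al * pauli K sg rh *
      epsUpD q r ga be) • (M al sg * Mb be rh)

/-- The Lorentz R-matrices
`𝓡^{±NM}_{LK} = (1/Q²) Σ R^{∓ακ}_{τσ} R^{∓μβ}_{κν} R^{±ρξ}_{δα} R^{±λγ}_{ξμ}
σ^{M β̇}_γ σ^{N λ̇}_ρ σ̄_{Lτ̇}^δ σ̄_{Kν̇}^σ`. -/
def Rlor (q r a : ℝ) (s : Bool) (N M L K : Fin 4) : ℂ :=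
  (1 / (Qval q r : ℂ) ^ 2) *
    ∑ al, ∑ be, ∑ ga, ∑ de, ∑ ka, ∑ l, ∑ mu, ∑ nu, ∑ xi, ∑ rh, ∑ sg, ∑ ta,
      Rm q r (if s then ((a : ℂ))⁻¹ else (a : ℂ)) al ka ta sg *
        Rm q r (if s then ((a : ℂ))⁻¹ else (a : ℂ)) mu be ka nu *
          Rm q r (if s then (a : ℂ) else ((a : ℂ))⁻¹) rh xi de al *
            Rm q r (if s then (a : ℂ) else ((a : ℂ))⁻¹) l ga xi mu *
              (∑ p, epsUpD q r be p * pauli M ga p) *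
                (∑ p, epsUpD q r l p * pauli N rh p) *
                  (∑ p, epsLoD q r ta p * sbarL q r a L p de) *
                    (∑ p, epsLoD q r nu p * sbarL q r a K p sg)

end

/-- If an invertible matrix factors through an index type of the same cardinality, the factors
are complete with respect to its inverse. -/
theorem Matrix.mul_inv_mul_eq_one_of_factor {m n R : Type*} [Fintype m] [DecidableEq m]
    [Fintype n] [DecidableEq n] [CommRing R] (hc : Fintype.card m = Fintype.card n)
    {G : Matrix m m R} {U : Matrix m n R} {V : Matrix n m R} (hG : IsUnit G.det)
    (h : G = U * V) : V * (G⁻¹ * U) = 1 := by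
  rw [← Matrix.mul_eq_one_comm_of_card_eq _ _ _ hc, Matrix.mul_assoc, ← h, Matrix.nonsing_inv_mul _ hG]

theorem sqrt_mul_self_complex {x : ℝ} (hx : 0 ≤ x) : (Real.sqrt x : ℂ) * Real.sqrt x = x := by
  rw [← Complex.ofReal_mul, Real.mul_self_sqrt hx]

theorem sqrt_ne_zero_complex {x : ℝ} (hx : 0 < x) : (Real.sqrt x : ℂ) ≠ 0 :=
  Complex.ofReal_ne_zero.mpr (Real.sqrt_pos.mpr hx).ne'

/-- The normalisation of the spinor metrics. -/
theorem inv_sqrt_mul_self_mul {r : ℝ} (hr : r ^ 2 < 1) :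
    ((Real.sqrt (1 - r ^ 2) : ℂ))⁻¹ * ((Real.sqrt (1 - r ^ 2) : ℂ))⁻¹ * (1 - (r : ℂ) ^ 2) = 1 := by
  have hd : (0 : ℝ) < 1 - r ^ 2 := by linarith
  have h := sqrt_mul_self_complex hd.le
  push_cast at h
  rw [← h]
  field_simp [sqrt_ne_zero_complex hd]

section SpinorMetrics

open scoped Matrix

variable {q r : ℝ}

theorem epsLo_mul_epsUp (hq : 0 < q) (hr : r ^ 2 < 1) : epsLo q r * epsUp q r = 1 := by
  have hn := inv_sqrt_mul_self_mul hr
  have hh : (Real.sqrt q : ℂ) * (Real.sqrt q : ℂ)⁻¹ = 1 :=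
    mul_inv_cancel₀ (sqrt_ne_zero_complex hq)
  have hI := Complex.I_mul_I
  unfold epsLo epsUp
  generalize ((Real.sqrt (1 - r ^ 2) : ℂ))⁻¹ = n at *
  generalize (Real.sqrt q : ℂ)⁻¹ = k at *
  ext i j
  fin_cases i <;> fin_cases j <;> simp [Matrix.mul_apply, Fin.sum_univ_two] <;> grind

theorem epsUpD_mul_epsUp_transpose (hq : 0 < q) (hr : r ^ 2 < 1) :
    epsUpD q r * (epsUp q r)ᵀ = -1 := by
  have hn := inv_sqrt_mul_self_mul hr
  have hh : (Real.sqrt q : ℂ) * (Real.sqrt q : ℂ)⁻¹ = 1 :=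
    mul_inv_cancel₀ (sqrt_ne_zero_complex hq)
  have hI := Complex.I_mul_I
  unfold epsUpD epsUp
  generalize ((Real.sqrt (1 - r ^ 2) : ℂ))⁻¹ = n at *
  generalize (Real.sqrt q : ℂ)⁻¹ = k at *
  ext i j
  fin_cases i <;> fin_cases j <;> simp [Matrix.mul_apply, Fin.sum_univ_two] <;> grind

theorem epsUpD_transpose_mul_epsLoD :
    (epsUpD q r)ᵀ * epsLoD q r = epsLo q r * (epsUp q r)ᵀ := by
  unfold epsUpD epsUp epsLo epsLoD
  ext i j
  fin_cases i <;> fin_cases j <;> simp [Matrix.mul_apply, Fin.sum_univ_two]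

/-- The conjugate of a matrix is, up to a scalar, a shift by a multiple of the identity. -/
theorem sbar_eq (hq : 0 < q) (hr : r ^ 2 < 1) (a : ℝ) (s : Bool) (X : Matrix (Fin 2) (Fin 2) ℂ) :
    Matrix.of (sbar q r a s X) = (-(if s then (Real.sqrt a : ℂ) else ((Real.sqrt a : ℂ))⁻¹)) •
      (X + ((if s then ((a : ℂ))⁻¹ else (a : ℂ)) *
        (X * (epsLo q r * (epsUp q r)ᵀ)).trace) • (1 : Matrix (Fin 2) (Fin 2) ℂ)) := by
  have h : Matrix.of (sbar q r a s X) = (if s then (Real.sqrt a : ℂ) else ((Real.sqrt a : ℂ))⁻¹) •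
      (epsUpD q r * (epsUp q r)ᵀ * X * (epsLo q r * epsUp q r) +
        ((if s then ((a : ℂ))⁻¹ else (a : ℂ)) *
        (X * (epsLo q r * (epsUp q r)ᵀ)).trace) •
          (epsUpD q r * (epsUp q r)ᵀ * (epsLo q r * epsUp q r))) := by
    ext i j
    simp only [Matrix.of_apply, sbar, Rm, Matrix.smul_apply, Matrix.add_apply, smul_eq_mul]
    generalize (if s then ((a : ℂ))⁻¹ else (a : ℂ)) = c
    congr 1
    simp [Matrix.mul_apply, Matrix.trace, Fin.sum_univ_two]
    ring
  rw [h, epsLo_mul_epsUp hq hr, epsUpD_mul_epsUp_transpose hq hr]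
  simp only [Matrix.mul_one, neg_mul, one_mul, smul_neg, neg_smul, smul_add]

theorem Gpair_eq_trace (a : ℝ) (s : Bool) (X Y : Matrix (Fin 2) (Fin 2) ℂ) :
    Gpair q r a s X Y = 1 / (Qval q r : ℂ) *
      (X * Matrix.of (sbar q r a s Y) * (epsLo q r * (epsUp q r)ᵀ)).trace := by
  rw [Gpair]
  congr 1
  simp only [Matrix.mul_apply, Matrix.trace, Fin.sum_univ_two, Matrix.transpose_apply,
    Matrix.diag_apply, Matrix.of_apply]
  ring

/-- The metric pairing may be computed by conjugating either argument. -/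
theorem Gpair_eq_trace_sbar_left (hq : 0 < q) (hr : r ^ 2 < 1) (a : ℝ) (s : Bool)
    (X Y : Matrix (Fin 2) (Fin 2) ℂ) :
    Gpair q r a s X Y = 1 / (Qval q r : ℂ) *
      (Matrix.of (sbar q r a s X) * Y * ((epsUpD q r)ᵀ * epsLoD q r)).trace := by
  rw [Gpair_eq_trace, epsUpD_transpose_mul_epsLoD, sbar_eq hq hr, sbar_eq hq hr]
  generalize epsLo q r * (epsUp q r)ᵀ = L
  congr 1
  simp only [Matrix.trace, Matrix.mul_apply, Fin.sum_univ_two, Matrix.diag_apply,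
    Matrix.smul_apply, Matrix.add_apply, smul_eq_mul, Matrix.one_apply_eq,
    Matrix.one_apply_ne zero_ne_one, Matrix.one_apply_ne one_ne_zero]
  ring

end SpinorMetrics

/-- completeness relations of the quantum Pauli matrices:
`Σ_I σ^{I β̇}_α σ̄_{±Iρ̇}^σ = Q δ^σ_α δ^{β̇}_{ρ̇}` and
`Σ_I σ_{±I β̇}^α σ̄^{I ρ̇}_{±σ} = Q δ^α_σ δ^{ρ̇}_{β̇}`. -/
theorem pauli_completeness (q r : ℝ) (hq : 0 < q) (hr : r ^ 2 < 1)
    (a : ℝ) (ha : 0 < a) (haQ : a + a⁻¹ = Qval q r)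
    (hG : ∀ s, IsUnit (GupM q r a s).det) :
    ∀ (s : Bool) (α β ρ σ : Fin 2),
      (∑ I, (∑ rh, epsUpD q r β rh * pauli I α rh) *
          (∑ ga, ∑ N, epsLoD q r ρ ga * GloM q r a s I N * sbar q r a s (pauli N) ga σ) =
        (Qval q r : ℂ) * (if α = σ then 1 else 0) * (if ρ = β then 1 else 0)) ∧
      (∑ I, (∑ rh, ∑ J, GloM q r a s I J * pauli J rh β * epsUp q r rh α) *
          (∑ b, sbar q r a s (pauli I) ρ b * epsLo q r b σ) =
        (Qval q r : ℂ) * (if α = σ then 1 else 0) * (if ρ = β then 1 else 0)) := by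
  have hQ : (Qval q r : ℂ) ≠ 0 := by
    rw [← haQ]
    exact_mod_cast (by positivity : a + a⁻¹ ≠ 0)
  have hcard : Fintype.card (Fin 4) = Fintype.card (Fin 2 × Fin 2) := rfl
  intro s α β ρ σ
  constructor
  · have hfac : GupM q r a s =
        (Matrix.of fun I (p : Fin 2 × Fin 2) =>
          ∑ ga, epsLoD q r p.2 ga * sbar q r a s (pauli I) ga p.1) *
        (Matrix.of fun (p : Fin 2 × Fin 2) J =>
          1 / (Qval q r : ℂ) * ∑ rh, epsUpD q r p.2 rh * pauli J p.1 rh) := by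
      ext I J
      rw [GupM, Gpair_eq_trace_sbar_left hq hr]
      simp only [Matrix.mul_apply, Matrix.trace, Fin.sum_univ_two, Matrix.transpose_apply,
        Matrix.diag_apply, Matrix.of_apply, Fintype.sum_prod_type]
      ring
    have h := congrFun₂ (Matrix.mul_inv_mul_eq_one_of_factor hcard (hG s) hfac) (α, β) (σ, ρ)
    simp only [Matrix.mul_apply, Matrix.of_apply, Matrix.one_apply, Prod.mk.injEq, eq_comm (a := β) (b := ρ)] at h
    rw [mul_assoc, ite_zero_mul_ite_zero, mul_one, ← h, Finset.mul_sum]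
    refine Finset.sum_congr rfl fun I _ => ?_
    rw [mul_assoc, ← mul_assoc (Qval q r : ℂ), mul_one_div_cancel hQ, one_mul, Finset.sum_comm]
    simp only [GloM, Finset.mul_sum]
    simp only [mul_left_comm, mul_assoc]
  · have hfac : GupM q r a s =
        (Matrix.of fun J (p : Fin 2 × Fin 2) => ∑ rh, pauli J rh p.2 * epsUp q r rh p.1) *
        (Matrix.of fun (p : Fin 2 × Fin 2) I =>
          1 / (Qval q r : ℂ) * ∑ b, sbar q r a s (pauli I) p.2 b * epsLo q r b p.1) := by
      ext I J
      simp only [GupM, Gpair, Matrix.mul_apply, Fin.sum_univ_two, Matrix.of_apply,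
        Fintype.sum_prod_type]
      ring
    have h := congrFun₂ (Matrix.mul_inv_mul_eq_one_of_factor hcard (hG s) hfac) (σ, ρ) (α, β)
    simp only [Matrix.mul_apply, Matrix.of_apply, Matrix.one_apply, Prod.mk.injEq, eq_comm (a := σ) (b := α)] at h
    rw [mul_assoc, ite_zero_mul_ite_zero, mul_one, ← h, Finset.mul_sum]
    refine Finset.sum_congr rfl fun I _ => ?_
    rw [mul_assoc, ← mul_assoc (Qval q r : ℂ), mul_one_div_cancel hQ, one_mul, Finset.sum_comm,
      mul_comm]
    simp only [GloM, Finset.mul_sum, mul_assoc]
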